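/- arXiv:1609.04498 — 2 statements merged into one kernel-verified Lean document; each statement's English description precedes it below -/
import Mathlib

section
/- Let (A,Ω) be a relative fractal drum in ℝ^N which is Minkowski nondegenerate, i.e., D := dim_B(A,Ω) exists and 0 < M_*^D(A,Ω) ≤ M^{*D}(A,Ω) < ∞. Fix δ > 0, let U ⊆ ℂ be an open connected neighborhood of D, and let F be meromorphic on U with F(s) = ζ̃_{A,Ω}(s;δ) for all s ∈ U with Re s > D. Then D is a simple pole of F: the limit r := lim_{s→D}(s−D)F(s) exists, is real and nonzero; moreover M_*^D(A,Ω) ≤ r ≤ M^{*D}(A,Ω), and if in addition (A,Ω) is Minkowski measurable then r = M^D(A,Ω). -/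
open MeasureTheory Filter Complex Set Metric Topology Asymptotics
open scoped ENNReal NNReal

noncomputable section

/-- The open `t`-neighborhood `A_t = {x : dist(x,A) < t}` of a set `A ⊆ ℝ^N`. -/
def nbhd (N : ℕ) (A : Set (EuclideanSpace ℝ (Fin N))) (t : ℝ) :
    Set (EuclideanSpace ℝ (Fin N)) :=
  {x | Metric.infDist x A < t}

/-- The volume `|A_t ∩ Ω|` of the `t`-neighborhood of `A` relative to `Ω`. -/
def tubeVol (N : ℕ) (A Ω : Set (EuclideanSpace ℝ (Fin N))) (t : ℝ) : ℝ :=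
  (volume (nbhd N A t ∩ Ω)).toReal

/-- The upper `r`-dimensional Minkowski content of the relative fractal drum `(A,Ω)`. -/
def upperContent (N : ℕ) (A Ω : Set (EuclideanSpace ℝ (Fin N))) (r : ℝ) : ℝ≥0∞ :=
  Filter.limsup
    (fun t : ℝ => volume (nbhd N A t ∩ Ω) / ENNReal.ofReal (t ^ ((N : ℝ) - r)))
    (nhdsWithin 0 (Set.Ioi 0))

/-- The lower `r`-dimensional Minkowski content of the relative fractal drum `(A,Ω)`. -/
def lowerContent (N : ℕ) (A Ω : Set (EuclideanSpace ℝ (Fin N))) (r : ℝ) : ℝ≥0∞ :=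
  Filter.liminf
    (fun t : ℝ => volume (nbhd N A t ∩ Ω) / ENNReal.ofReal (t ^ ((N : ℝ) - r)))
    (nhdsWithin 0 (Set.Ioi 0))

/-- `D` is the (finite) upper box (Minkowski) dimension of `(A,Ω)`:
the greatest lower bound of `{r : M^{*r}(A,Ω) = 0}`. -/
def IsUpperMinkDim (N : ℕ) (A Ω : Set (EuclideanSpace ℝ (Fin N))) (D : ℝ) : Prop :=
  IsGLB {r : ℝ | upperContent N A Ω r = 0} D

/-- `D` is the (finite) lower box (Minkowski) dimension of `(A,Ω)`. -/
def IsLowerMinkDim (N : ℕ) (A Ω : Set (EuclideanSpace ℝ (Fin N))) (D : ℝ) : Prop :=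
  IsGLB {r : ℝ | lowerContent N A Ω r = 0} D

/-- The box (Minkowski) dimension of `(A,Ω)` exists and equals `D`. -/
def IsMinkDim (N : ℕ) (A Ω : Set (EuclideanSpace ℝ (Fin N))) (D : ℝ) : Prop :=
  IsUpperMinkDim N A Ω D ∧ IsLowerMinkDim N A Ω D

/-- `(A,Ω)` is a relative fractal drum in `ℝ^N`. -/
def IsRFD (N : ℕ) (A Ω : Set (EuclideanSpace ℝ (Fin N))) : Prop :=
  A.Nonempty ∧ MeasurableSet Ω ∧ volume Ω < ⊤ ∧ ∃ δ₀ > (0 : ℝ), Ω ⊆ nbhd N A δ₀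

/-- The relative distance zeta function `ζ_{A,Ω}(s) = ∫_Ω d(x,A)^{s-N} dx`. -/
def distZeta (N : ℕ) (A Ω : Set (EuclideanSpace ℝ (Fin N))) (s : ℂ) : ℂ :=
  ∫ x in Ω, (Metric.infDist x A : ℂ) ^ (s - (N : ℂ))

/-- The relative distance zeta function with parameter `δ`:
`ζ_{A,Ω}(s;δ) = ∫_{A_δ ∩ Ω} d(x,A)^{s-N} dx`. -/
def distZetaD (N : ℕ) (A Ω : Set (EuclideanSpace ℝ (Fin N))) (δ : ℝ) (s : ℂ) : ℂ :=
  ∫ x in nbhd N A δ ∩ Ω, (Metric.infDist x A : ℂ) ^ (s - (N : ℂ))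

/-- The relative tube zeta function `ζ̃_{A,Ω}(s;δ) = ∫_0^δ t^{s-N-1}|A_t ∩ Ω| dt`. -/
def tubeZeta (N : ℕ) (A Ω : Set (EuclideanSpace ℝ (Fin N))) (δ : ℝ) (s : ℂ) : ℂ :=
  ∫ t in Set.Ioc (0 : ℝ) δ, (t : ℂ) ^ (s - (N : ℂ) - 1) * ((tubeVol N A Ω t : ℝ) : ℂ)

/-- The Mellin zeta function `ζ^𝔐_{A,Ω}(s) = ∫_0^∞ t^{s-N-1}|A_t ∩ Ω| dt`. -/
def mellinZeta (N : ℕ) (A Ω : Set (EuclideanSpace ℝ (Fin N))) (s : ℂ) : ℂ :=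
  ∫ t in Set.Ioi (0 : ℝ), (t : ℂ) ^ (s - (N : ℂ) - 1) * ((tubeVol N A Ω t : ℝ) : ℂ)

/-- `(A,Ω)` is Minkowski measurable with dimension `D` and Minkowski content `M`. -/
def MinkMeasurable (N : ℕ) (A Ω : Set (EuclideanSpace ℝ (Fin N))) (D M : ℝ) : Prop :=
  0 < M ∧
    Tendsto (fun t : ℝ => tubeVol N A Ω t / t ^ ((N : ℝ) - D))
      (nhdsWithin 0 (Set.Ioi 0)) (nhds M)

/-- `ω` is a pole of `F` (the norm of `F` blows up at `ω`). -/
def IsPoleAt (F : ℂ → ℂ) (ω : ℂ) : Prop :=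
  Tendsto (fun s => ‖F s‖) (nhdsWithin ω {ω}ᶜ) atTop

/-- The languidity conditions **L1**–**L2** for `F` with screen `S`, exponent `κ`,
constants `c`, `C` and two-sided sequence `T`. -/
def LanguidWith (F : ℂ → ℂ) (S : ℝ → ℝ) (κ c C : ℝ) (T : ℤ → ℝ) : Prop :=
  0 < C ∧
  (∀ n : ℤ, 1 ≤ n → T (-n) < 0 ∧ 0 < T n) ∧
  Tendsto (fun n : ℕ => T (n : ℤ)) atTop atTop ∧
  Tendsto (fun n : ℕ => T (-(n : ℤ))) atTop atBot ∧
  (∀ n : ℤ, ∀ σ : ℝ, S (T n) < σ → σ < c →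
    ‖F ((σ : ℂ) + (T n : ℝ) * Complex.I)‖ ≤ C * (|T n| + 1) ^ κ) ∧
  (∀ τ : ℝ, 1 ≤ |τ| → ‖F ((S τ : ℂ) + (τ : ℝ) * Complex.I)‖ ≤ C * |τ| ^ κ)

/-- `S` is a screen (for upper box dimension `D`): a Lipschitz function bounded below,
with `sup S ≤ D`. -/
def IsScreen (S : ℝ → ℝ) (D : ℝ) : Prop :=
  (∃ K : NNReal, LipschitzWith K S) ∧ BddBelow (Set.range S) ∧ ∀ τ : ℝ, S τ ≤ D

/-- The window associated with the screen `S`. -/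
def window (S : ℝ → ℝ) : Set ℂ :=
  {s : ℂ | S s.im ≤ s.re}


section AbelianBounds

variable {h : ℝ → ℝ} {δ B : ℝ}

lemma integrableOn_rpow_sub_one {x : ℝ} (hδ : 0 < δ) (hx : 0 < x) :
    IntegrableOn (fun t : ℝ => t ^ (x - 1)) (Ioc 0 δ) :=
  (intervalIntegrable_iff_integrableOn_Ioc_of_le hδ.le).1
    (intervalIntegral.intervalIntegrable_rpow' (by linarith))

lemma setIntegral_Ioc_rpow_sub_one {a b x : ℝ} (hab : a ≤ b) (hx : 0 < x) :
    ∫ t in Ioc a b, t ^ (x - 1) = (b ^ x - a ^ x) / x := by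
  rw [← intervalIntegral.integral_of_le hab, integral_rpow (Or.inl (by linarith)),
    sub_add_cancel]

lemma integrableOn_rpow_mul {x : ℝ} (hδ : 0 < δ) (hx : 0 < x)
    (hm : AEStronglyMeasurable h (volume.restrict (Ioc 0 δ)))
    (hB : ∀ t ∈ Ioc 0 δ, |h t| ≤ B) :
    IntegrableOn (fun t => t ^ (x - 1) * h t) (Ioc 0 δ) :=
  (integrableOn_rpow_sub_one hδ hx).mul_bdd (c := B) hm
    ((ae_restrict_iff' measurableSet_Ioc).2 (Eventually.of_forall hB))

lemma tendsto_rpow_nhdsGT_zero {a : ℝ} (ha : 0 < a) :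
    Tendsto (fun x : ℝ => a ^ x) (𝓝[>] 0) (𝓝 1) := by
  have := (Real.continuous_const_rpow ha.ne').tendsto 0
  rw [Real.rpow_zero] at this
  exact this.mono_left nhdsWithin_le_nhds

/-- If `h ≤ b` near `0`, then any limit of `x ∫₀^δ t^(x-1) h(t) dt` as `x → 0⁺` is at most `b`. -/
lemma limit_mul_integral_rpow_le {b r : ℝ} (hδ : 0 < δ)
    (hm : AEStronglyMeasurable h (volume.restrict (Ioc 0 δ)))
    (hB : ∀ t ∈ Ioc 0 δ, |h t| ≤ B) (hb : ∀ᶠ t in 𝓝[>] 0, h t ≤ b)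
    (hr : Tendsto (fun x : ℝ => x * ∫ t in Ioc 0 δ, t ^ (x - 1) * h t) (𝓝[>] 0) (𝓝 r)) :
    r ≤ b := by
  obtain ⟨τ', hτ', hsub⟩ := mem_nhdsGT_iff_exists_Ioc_subset.1 hb
  obtain ⟨τ, hτ0, hττ', hτδ⟩ : ∃ τ, 0 < τ ∧ τ ≤ τ' ∧ τ ≤ δ :=
    ⟨min τ' δ, lt_min hτ' hδ, min_le_left _ _, min_le_right _ _⟩
  set K := B + |b|
  have hlim : Tendsto (fun x : ℝ => δ ^ x * b + (δ ^ x - τ ^ x) * K) (𝓝[>] 0) (𝓝 b) := by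
    have h1 := tendsto_rpow_nhdsGT_zero hδ
    have h2 := tendsto_rpow_nhdsGT_zero hτ0
    simpa using (h1.mul_const b).add ((h1.sub h2).mul_const K)
  refine le_of_tendsto_of_tendsto hr hlim ?_
  filter_upwards [self_mem_nhdsWithin] with x hx
  have hx : 0 < x := hx
  have hi := integrableOn_rpow_sub_one hδ hx
  have hii : IntegrableOn
      ((Ioc τ δ).indicator fun t : ℝ => t ^ (x - 1) * K) (Ioc 0 δ) :=
    (hi.mul_const K).indicator measurableSet_Ioc
  have hle : ∫ t in Ioc 0 δ, t ^ (x - 1) * h t ≤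
      ∫ t in Ioc 0 δ, (t ^ (x - 1) * b +
        (Ioc τ δ).indicator (fun t : ℝ => t ^ (x - 1) * K) t) := by
    refine setIntegral_mono_on (integrableOn_rpow_mul hδ hx hm hB)
      ((hi.mul_const b).add hii) measurableSet_Ioc fun t ht => ?_
    have hp : 0 ≤ t ^ (x - 1) := Real.rpow_nonneg ht.1.le _
    by_cases htτ : t ≤ τ
    · rw [indicator_of_notMem (fun hmem => htτ.not_gt hmem.1), add_zero]
      exact mul_le_mul_of_nonneg_left (hsub ⟨ht.1, htτ.trans hττ'⟩) hp
    · rw [indicator_of_mem (show t ∈ Ioc τ δ from ⟨not_le.1 htτ, ht.2⟩), ← mul_add]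
      refine mul_le_mul_of_nonneg_left ?_ hp
      have h1 := (abs_le.1 (hB t ht)).2
      have h2 := neg_abs_le b
      simp only [K]
      linarith
  calc x * ∫ t in Ioc 0 δ, t ^ (x - 1) * h t
      ≤ x * ∫ t in Ioc 0 δ, (t ^ (x - 1) * b +
        (Ioc τ δ).indicator (fun t : ℝ => t ^ (x - 1) * K) t) :=
        mul_le_mul_of_nonneg_left hle hx.le
    _ = δ ^ x * b + (δ ^ x - τ ^ x) * K := by
        rw [integral_add (hi.mul_const b) hii, setIntegral_indicator measurableSet_Ioc,
          inter_eq_right.2 (Ioc_subset_Ioc_left hτ0.le), integral_mul_const,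
          integral_mul_const, setIntegral_Ioc_rpow_sub_one hδ.le hx,
          setIntegral_Ioc_rpow_sub_one hτδ hx, Real.zero_rpow hx.ne']
        field_simp
        ring

/-- If `a ≤ h` near `0`, then any limit of `x ∫₀^δ t^(x-1) h(t) dt` as `x → 0⁺` is at least `a`. -/
lemma le_limit_mul_integral_rpow {a r : ℝ} (hδ : 0 < δ)
    (hm : AEStronglyMeasurable h (volume.restrict (Ioc 0 δ)))
    (hB : ∀ t ∈ Ioc 0 δ, |h t| ≤ B) (ha : ∀ᶠ t in 𝓝[>] 0, a ≤ h t)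
    (hr : Tendsto (fun x : ℝ => x * ∫ t in Ioc 0 δ, t ^ (x - 1) * h t) (𝓝[>] 0) (𝓝 r)) :
    a ≤ r := by
  refine neg_le_neg_iff.1 (limit_mul_integral_rpow_le (h := fun t => -h t) (B := B) hδ hm.neg
    (fun t ht => by rw [abs_neg]; exact hB t ht) (ha.mono fun t ht => neg_le_neg ht) ?_)
  simpa only [mul_neg, integral_neg] using hr.neg

lemma abs_mul_integral_rpow_le {x : ℝ} (hδ : 0 < δ) (hx : 0 < x)
    (hB : ∀ t ∈ Ioc 0 δ, |h t| ≤ B) :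
    |x * ∫ t in Ioc 0 δ, t ^ (x - 1) * h t| ≤ δ ^ x * B := by
  have hle : ‖∫ t in Ioc 0 δ, t ^ (x - 1) * h t‖ ≤ ∫ t in Ioc 0 δ, t ^ (x - 1) * B := by
    refine norm_integral_le_of_norm_le ((integrableOn_rpow_sub_one hδ hx).mul_const B)
      ((ae_restrict_iff' measurableSet_Ioc).2 (Eventually.of_forall fun t ht => ?_))
    have hp : 0 ≤ t ^ (x - 1) := Real.rpow_nonneg ht.1.le _
    rw [norm_mul, Real.norm_of_nonneg hp]
    exact mul_le_mul_of_nonneg_left (hB t ht) hp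
  rw [abs_mul, abs_of_pos hx]
  calc x * |∫ t in Ioc 0 δ, t ^ (x - 1) * h t| ≤ x * ∫ t in Ioc 0 δ, t ^ (x - 1) * B :=
        mul_le_mul_of_nonneg_left hle hx.le
    _ = δ ^ x * B := by
        rw [integral_mul_const, setIntegral_Ioc_rpow_sub_one hδ.le hx, Real.zero_rpow hx.ne']
        field_simp
        ring

end AbelianBounds

section Tube

variable {N : ℕ} {A Ω : Set (EuclideanSpace ℝ (Fin N))}

lemma tubeVol_nonneg (t : ℝ) : 0 ≤ tubeVol N A Ω t := ENNReal.toReal_nonneg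

lemma tubeVol_mono (hΩ : volume Ω < ⊤) : Monotone (tubeVol N A Ω) := fun _ _ hst =>
  ENNReal.toReal_mono ((measure_mono inter_subset_right).trans_lt hΩ).ne
    (measure_mono (inter_subset_inter_left _ fun _ hx => lt_of_lt_of_le hx hst))

lemma toReal_volume_div_eq {E t : ℝ} (ht : 0 < t) :
    (volume (nbhd N A t ∩ Ω) / ENNReal.ofReal (t ^ E)).toReal = tubeVol N A Ω t / t ^ E := by
  rw [ENNReal.toReal_div, ENNReal.toReal_ofReal (Real.rpow_nonneg ht.le _), tubeVol]

lemma volume_div_ne_top {E t : ℝ} (hΩ : volume Ω < ⊤) (ht : 0 < t) :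
    volume (nbhd N A t ∩ Ω) / ENNReal.ofReal (t ^ E) ≠ ⊤ :=
  ENNReal.div_ne_top ((measure_mono inter_subset_right).trans_lt hΩ).ne
    (ENNReal.ofReal_pos.2 (Real.rpow_pos_of_pos ht _)).ne'

lemma eventually_le_tubeVol_div {a D : ℝ} (hΩ : volume Ω < ⊤)
    (ha : a < (lowerContent N A Ω D).toReal) :
    ∀ᶠ t in 𝓝[>] (0 : ℝ), a ≤ tubeVol N A Ω t / t ^ ((N : ℝ) - D) := by
  rcases lt_or_ge a 0 with h0 | h0
  · filter_upwards [self_mem_nhdsWithin] with t ht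
    exact h0.le.trans (div_nonneg (tubeVol_nonneg t) (Real.rpow_nonneg (le_of_lt ht) _))
  · have h1 : ENNReal.ofReal a < lowerContent N A Ω D :=
      (ENNReal.ofReal_lt_iff_lt_toReal h0
        (fun h => by simp [h] at ha; exact ha.not_ge h0)).2 ha
    filter_upwards [eventually_lt_of_lt_liminf h1, self_mem_nhdsWithin] with t h2 ht
    rw [← toReal_volume_div_eq ht]
    exact (ENNReal.ofReal_le_iff_le_toReal (volume_div_ne_top hΩ ht)).1 h2.le

lemma eventually_tubeVol_div_le {b D : ℝ} (hU : upperContent N A Ω D ≠ ⊤)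
    (hb : (upperContent N A Ω D).toReal < b) :
    ∀ᶠ t in 𝓝[>] (0 : ℝ), tubeVol N A Ω t / t ^ ((N : ℝ) - D) ≤ b := by
  have h1 : upperContent N A Ω D < ENNReal.ofReal b := (ENNReal.lt_ofReal_iff_toReal_lt hU).2 hb
  filter_upwards [eventually_lt_of_limsup_lt h1, self_mem_nhdsWithin] with t h2 ht
  rw [← toReal_volume_div_eq ht]
  exact ENNReal.toReal_le_of_le_ofReal (ENNReal.toReal_nonneg.trans hb.le) h2.le

lemma exists_abs_tubeVol_div_le {D δ : ℝ} (hΩ : volume Ω < ⊤) (hU : upperContent N A Ω D ≠ ⊤) :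
    ∃ B, ∀ t ∈ Ioc 0 δ, |tubeVol N A Ω t / t ^ ((N : ℝ) - D)| ≤ B := by
  obtain ⟨b, hb⟩ := exists_gt (upperContent N A Ω D).toReal
  obtain ⟨τ, hτ, hsub⟩ := mem_nhdsGT_iff_exists_Ioc_subset.1 (eventually_tubeVol_div_le hU hb)
  have hτ : 0 < τ := hτ
  have hcont : ContinuousOn (fun t : ℝ => tubeVol N A Ω δ / t ^ ((N : ℝ) - D)) (Icc τ δ) :=
    continuousOn_const.div
      (continuousOn_id.rpow_const fun t ht => Or.inl (hτ.trans_le ht.1).ne')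
      fun t ht => (Real.rpow_pos_of_pos (hτ.trans_le ht.1) _).ne'
  obtain ⟨C, hC⟩ := isCompact_Icc.exists_bound_of_continuousOn hcont
  refine ⟨max b C, fun t ht => ?_⟩
  have hp : 0 < t ^ ((N : ℝ) - D) := Real.rpow_pos_of_pos ht.1 _
  rw [abs_of_nonneg (div_nonneg (tubeVol_nonneg t) hp.le)]
  rcases le_total t τ with h | h
  · exact le_max_of_le_left (hsub ⟨ht.1, h⟩)
  · refine le_max_of_le_right (le_trans ?_ ((le_abs_self _).trans (hC t ⟨h, ht.2⟩)))
    exact div_le_div_of_nonneg_right (tubeVol_mono hΩ ht.2) hp.le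

lemma aestronglyMeasurable_tubeVol_div {D : ℝ} {μ : Measure ℝ} (hΩ : volume Ω < ⊤) :
    AEStronglyMeasurable (fun t => tubeVol N A Ω t / t ^ ((N : ℝ) - D)) μ :=
  ((tubeVol_mono hΩ).measurable.div (by fun_prop)).aestronglyMeasurable

/-- On the real axis, the tube zeta function is the Mellin transform of the normalized volume. -/
lemma tubeZeta_add_ofReal (D δ x : ℝ) :
    tubeZeta N A Ω δ ((D : ℂ) + x) =
      ((∫ t in Ioc 0 δ, t ^ (x - 1) * (tubeVol N A Ω t / t ^ ((N : ℝ) - D)) : ℝ) : ℂ) := by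
  rw [tubeZeta, ← integral_complex_ofReal]
  refine setIntegral_congr_fun measurableSet_Ioc fun t ht => ?_
  have hpow : t ^ (x - 1) * (tubeVol N A Ω t / t ^ ((N : ℝ) - D)) =
      t ^ (D + x - N - 1) * tubeVol N A Ω t := by
    rw [mul_div_left_comm, ← Real.rpow_sub ht.1, mul_comm]
    ring_nf
  simp only [hpow]
  push_cast [Complex.ofReal_cpow ht.1.le]
  rfl

end Tube

/-- A meromorphic function bounded along a nontrivial filter approaching a point has a limit
there. -/
lemma MeromorphicAt.exists_tendsto_nhds_of_eventually_norm_le {G : ℂ → ℂ} {z : ℂ}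
    (hG : MeromorphicAt G z) {l : Filter ℂ} [l.NeBot] (hl : l ≤ 𝓝[≠] z) {C : ℝ}
    (hC : ∀ᶠ s in l, ‖G s‖ ≤ C) : ∃ c, Tendsto G (𝓝[≠] z) (𝓝 c) := by
  refine tendsto_nhds_of_meromorphicOrderAt_nonneg hG (not_lt.1 fun hneg => ?_)
  have h1 := tendsto_norm_cobounded_atTop.comp (tendsto_cobounded_of_meromorphicOrderAt_neg hneg)
  obtain ⟨s, hs, hs'⟩ := (hC.and ((h1.mono_left hl).eventually_gt_atTop C)).exists
  exact hs.not_gt hs'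

lemma tendsto_const_add_ofReal_nhdsNE (D : ℝ) :
    Tendsto (fun x : ℝ => (D : ℂ) + x) (𝓝[>] 0) (𝓝[≠] (D : ℂ)) := by
  refine tendsto_nhdsWithin_iff.2 ⟨?_, ?_⟩
  · have : Continuous fun x : ℝ => (D : ℂ) + x := by fun_prop
    simpa using (this.tendsto 0).mono_left nhdsWithin_le_nhds
  · filter_upwards [self_mem_nhdsWithin] with x hx
    simpa using (ne_of_gt hx : x ≠ 0)

/-- Let `(A,Ω)` be a Minkowski nondegenerate RFD in `ℝ^N` with `D := dim_B(A,Ω)`.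
Fix `δ > 0`, let `U` be an open connected neighborhood of `D` and `F` meromorphic on `U`
agreeing with `ζ̃_{A,Ω}(·;δ)` on `{Re s > D}`.  Then `D` is a simple pole of `F`:
the limit `r := lim_{s→D}(s−D)F(s)` exists, is real and nonzero; moreover
`M_*^D(A,Ω) ≤ r ≤ M^{*D}(A,Ω)`, and if `(A,Ω)` is Minkowski measurable then
`r = M^D(A,Ω)`. -/
theorem statement4
    (N : ℕ) (A Ω : Set (EuclideanSpace ℝ (Fin N))) (D δ : ℝ) (U : Set ℂ) (F : ℂ → ℂ)
    (hRFD : IsRFD N A Ω) (hD : IsMinkDim N A Ω D)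
    (hnd₁ : 0 < lowerContent N A Ω D) (hnd₂ : upperContent N A Ω D < ⊤)
    (hδ : 0 < δ)
    (hU : IsOpen U) (hUconn : IsPreconnected U) (hDU : (D : ℂ) ∈ U)
    (hF : MeromorphicOn F U)
    (hFzeta : ∀ s ∈ U, D < s.re → F s = tubeZeta N A Ω δ s) :
    ∃ r : ℝ, r ≠ 0 ∧
      Tendsto (fun s : ℂ => (s - (D : ℂ)) * F s)
        (nhdsWithin (D : ℂ) {(D : ℂ)}ᶜ) (nhds (r : ℂ)) ∧
      (lowerContent N A Ω D).toReal ≤ r ∧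
      r ≤ (upperContent N A Ω D).toReal ∧
      ∀ M : ℝ, MinkMeasurable N A Ω D M → r = M := by
  have hΩ := hRFD.2.2.1
  set h : ℝ → ℝ := fun t => tubeVol N A Ω t / t ^ ((N : ℝ) - D)
  have hm : AEStronglyMeasurable h (volume.restrict (Ioc 0 δ)) :=
    aestronglyMeasurable_tubeVol_div hΩ
  obtain ⟨B, hB⟩ : ∃ B, ∀ t ∈ Ioc 0 δ, |h t| ≤ B := exists_abs_tubeVol_div_le hΩ hnd₂.ne
  set G : ℂ → ℂ := fun s => (s - (D : ℂ)) * F s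
  set I : ℝ → ℝ := fun x => x * ∫ t in Ioc 0 δ, t ^ (x - 1) * h t
  have hpath := tendsto_const_add_ofReal_nhdsNE D
  have hGI : ∀ᶠ x : ℝ in 𝓝[>] 0, G (D + x) = (I x : ℂ) := by
    filter_upwards [self_mem_nhdsWithin,
      hpath.eventually (mem_nhdsWithin_of_mem_nhds (hU.mem_nhds hDU))] with x hx hxU
    have hx : 0 < x := hx
    simp only [G, I]
    rw [hFzeta _ hxU (by simpa using hx), tubeZeta_add_ofReal, add_sub_cancel_left, ofReal_mul]
  have hbdd : ∀ᶠ x : ℝ in 𝓝[>] 0, ‖G (D + x)‖ ≤ B + 1 := by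
    have hlim : Tendsto (fun x : ℝ => δ ^ x * B) (𝓝[>] 0) (𝓝 B) := by
      simpa using (tendsto_rpow_nhdsGT_zero hδ).mul_const B
    filter_upwards [hGI, self_mem_nhdsWithin, hlim.eventually (gt_mem_nhds (lt_add_one B))]
      with x hx hx0 hxB
    rw [hx, Complex.norm_real, Real.norm_eq_abs]
    exact (abs_mul_integral_rpow_le hδ hx0 hB).trans hxB.le
  have hGmero : MeromorphicAt G D :=
    ((MeromorphicAt.id _).sub (MeromorphicAt.const _ _)).mul (hF _ hDU)
  obtain ⟨c, hc⟩ := hGmero.exists_tendsto_nhds_of_eventually_norm_le hpath (eventually_map.2 hbdd)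
  have hIc : Tendsto (fun x => (I x : ℂ)) (𝓝[>] 0) (𝓝 c) := (hc.comp hpath).congr' hGI
  have hIr : Tendsto I (𝓝[>] 0) (𝓝 c.re) :=
    (Complex.continuous_re.tendsto c).comp hIc
  have hcr : c = (c.re : ℂ) :=
    tendsto_nhds_unique hIc ((Complex.continuous_ofReal.tendsto _).comp hIr)
  have hlow : (lowerContent N A Ω D).toReal ≤ c.re := le_of_forall_lt_imp_le_of_dense fun a ha =>
    le_limit_mul_integral_rpow hδ hm hB (eventually_le_tubeVol_div hΩ ha) hIr
  have hupp : c.re ≤ (upperContent N A Ω D).toReal := le_of_forall_gt_imp_ge_of_dense fun b hb =>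
    limit_mul_integral_rpow_le hδ hm hB (eventually_tubeVol_div_le hnd₂.ne hb) hIr
  have hlu : lowerContent N A Ω D ≤ upperContent N A Ω D := liminf_le_limsup
  refine ⟨c.re, ?_, hcr ▸ hc, hlow, hupp, fun M hM => le_antisymm ?_ ?_⟩
  · exact ((ENNReal.toReal_pos hnd₁.ne' (hlu.trans_lt hnd₂).ne).trans_le hlow).ne'
  · exact le_of_forall_gt_imp_ge_of_dense fun b hb =>
      limit_mul_integral_rpow_le hδ hm hB
        ((hM.2.eventually (gt_mem_nhds hb)).mono fun _ ht => ht.le) hIr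
  · exact le_of_forall_lt_imp_le_of_dense fun a ha =>
      le_limit_mul_integral_rpow hδ hm hB
        ((hM.2.eventually (lt_mem_nhds ha)).mono fun _ ht => ht.le) hIr

end
end

section
/- Let (A,Ω) be a relative fractal drum in ℝ^N and let δ, δ₁ > 0. Then: (i) the function E(s) := ∫_{(A_{δ₁}∩Ω)∖A_δ} dist(x,A)^{s−N} dx − ∫_{(A_δ∩Ω)∖A_{δ₁}} dist(x,A)^{s−N} dx is an entire function of s ∈ ℂ, and ζ_{A,Ω}(s;δ₁) = ζ_{A,Ω}(s;δ) + E(s) for all s with Re s > dim̄_B(A,Ω); (ii) if S is a screen, U an open connected neighborhood of its window W, and F a meromorphic extension of ζ_{A,Ω}(·;δ) to U satisfying the languidity conditions (L1)–(L2) with exponent κ_d ∈ ℝ (for some constants c > N, C > 0 and admissible sequence (T_n)), then F + E is a meromorphic extension of ζ_{A,Ω}(·;δ₁) to U and satisfies (L1)–(L2) with the same screen, sequence and constant c, with exponent max{κ_d, 0} and some constant C₁ > 0. -/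
open MeasureTheory Filter Complex Set Metric Topology Asymptotics
open scoped ENNReal NNReal

noncomputable section

/-- The entire correction term
`E(s) := ∫_{(A_{δ₁}∩Ω)∖A_δ} d(x,A)^{s−N} dx − ∫_{(A_δ∩Ω)∖A_{δ₁}} d(x,A)^{s−N} dx`. -/
def corrTerm (N : ℕ) (A Ω : Set (EuclideanSpace ℝ (Fin N))) (δ δ₁ : ℝ) (s : ℂ) : ℂ :=
  (∫ x in (nbhd N A δ₁ ∩ Ω) \ nbhd N A δ, (Metric.infDist x A : ℂ) ^ (s - (N : ℂ))) -
  (∫ x in (nbhd N A δ ∩ Ω) \ nbhd N A δ₁, (Metric.infDist x A : ℂ) ^ (s - (N : ℂ)))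

/-- If the sublevel sets `{g < t}` of a nonnegative function have measure at most `t ^ q` for small
`t`, then `g ^ (-p)` is integrable for every `0 < p < q`. -/
theorem integrable_rpow_neg_of_measure_lt_le {α : Type*} [MeasurableSpace α] {μ : Measure α}
    [IsFiniteMeasure μ] {g : α → ℝ} (hg : Measurable g) (hg0 : ∀ x, 0 ≤ g x) {p q t₀ : ℝ}
    (hp : 0 < p) (hpq : p < q) (ht₀ : 0 < t₀)
    (h : ∀ t ∈ Ioo 0 t₀, μ {x | g x < t} ≤ ENNReal.ofReal (t ^ q)) :
    Integrable (fun x => g x ^ (-p)) μ := by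
  have hm : Measurable fun x => g x ^ (-p) := hg.pow_const _
  have hnn : ∀ x, 0 ≤ g x ^ (-p) := fun x => Real.rpow_nonneg (hg0 x) _
  refine ⟨hm.aestronglyMeasurable, ?_⟩
  rw [hasFiniteIntegral_iff_ofReal (Eventually.of_forall hnn),
    lintegral_eq_lintegral_meas_lt μ (Eventually.of_forall hnn) hm.aemeasurable]
  set K : ℝ := t₀ ^ (-p) with hK
  have hKpos : 0 < K := Real.rpow_pos_of_pos ht₀ _
  have hbound : ∀ t ∈ Ioi K, μ {x | t < g x ^ (-p)} ≤ ENNReal.ofReal (t ^ (-(q / p))) := by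
    intro t ht
    have htpos : 0 < t := hKpos.trans ht
    have hanti : ∀ {a b : ℝ}, 0 < a → a < b → b ^ (-p⁻¹) < a ^ (-p⁻¹) := fun ha hab =>
      Real.rpow_lt_rpow_of_neg ha hab (by simpa using hp)
    have hcancel : ∀ {a : ℝ}, 0 ≤ a → (a ^ (-p)) ^ (-p⁻¹) = a := fun ha => by
      rw [← Real.rpow_mul ha]
      have : -p * -p⁻¹ = 1 := by field_simp
      rw [this, Real.rpow_one]
    have hsub : {x | t < g x ^ (-p)} ⊆ {x | g x < t ^ (-p⁻¹)} := by
      intro x hx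
      have := hanti htpos hx
      rwa [hcancel (hg0 x)] at this
    have hlt : t ^ (-p⁻¹) < t₀ := by
      have := hanti hKpos ht
      rwa [hK, hcancel ht₀.le] at this
    refine (measure_mono hsub).trans ((h _ ⟨Real.rpow_pos_of_pos htpos _, hlt⟩).trans_eq ?_)
    rw [← Real.rpow_mul htpos.le]
    congr 2
    field_simp
  rw [← Ioc_union_Ioi_eq_Ioi hKpos.le]
  refine (lintegral_union_le _ _ _).trans_lt (ENNReal.add_lt_top.2 ⟨?_, ?_⟩)
  · calc ∫⁻ t in Ioc 0 K, μ {x | t < g x ^ (-p)}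
        ≤ ∫⁻ _ in Ioc 0 K, μ univ := lintegral_mono fun t => measure_mono (subset_univ _)
      _ < ⊤ := by
        rw [setLIntegral_const]
        exact ENNReal.mul_lt_top (measure_lt_top _ _) (by simp)
  · refine (setLIntegral_mono' measurableSet_Ioi hbound).trans_lt ?_
    have hint : IntegrableOn (fun t : ℝ => t ^ (-(q / p))) (Ioi K) :=
      integrableOn_Ioi_rpow_of_lt (by rw [neg_lt_neg_iff, one_lt_div hp]; exact hpq) hKpos
    rw [← ofReal_integral_eq_lintegral_ofReal hint]
    · exact ENNReal.ofReal_lt_top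
    · filter_upwards [ae_restrict_mem measurableSet_Ioi] with t ht
      exact Real.rpow_nonneg (hKpos.trans ht).le _

theorem measurableSet_nbhd (N : ℕ) (A : Set (EuclideanSpace ℝ (Fin N))) (t : ℝ) :
    MeasurableSet (nbhd N A t) :=
  measurableSet_lt (continuous_infDist_pt A).measurable measurable_const

/-- The integrand of the distance zeta function is integrable on `A_δ ∩ Ω` to the right of the
upper box dimension. -/
theorem integrableOn_infDist_cpow {N : ℕ} {A Ω : Set (EuclideanSpace ℝ (Fin N))} {D : ℝ}
    (hΩ : MeasurableSet Ω) (hfin : volume Ω < ⊤) (hD : IsUpperMinkDim N A Ω D) (δ : ℝ) {s : ℂ}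
    (hs : D < s.re) :
    IntegrableOn (fun x => (infDist x A : ℂ) ^ (s - (N : ℂ))) (nbhd N A δ ∩ Ω) := by
  have hdm : Measurable fun x : EuclideanSpace ℝ (Fin N) => infDist x A :=
    (continuous_infDist_pt A).measurable
  have hmeas : Measurable fun x : EuclideanSpace ℝ (Fin N) =>
      (infDist x A : ℂ) ^ (s - (N : ℂ)) := (measurable_ofReal.comp hdm).pow_const _
  have : IsFiniteMeasure (volume.restrict Ω) := ⟨by simpa using hfin⟩
  have hre : (s - (N : ℂ)).re = s.re - N := by simp
  rcases lt_or_ge s.re N with hsN | hsN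
  · obtain ⟨r, hr, -, hrs⟩ := hD.exists_between hs
    have hev : ∀ᶠ t in 𝓝[>] (0 : ℝ),
        volume (nbhd N A t ∩ Ω) / ENNReal.ofReal (t ^ ((N : ℝ) - r)) < 1 :=
      eventually_lt_of_limsup_lt (lt_of_eq_of_lt hr one_pos)
    obtain ⟨t₀, ht₀, hsub⟩ := mem_nhdsGT_iff_exists_Ioo_subset.1 hev
    have hint := integrable_rpow_neg_of_measure_lt_le (μ := volume.restrict Ω) hdm
      (fun _ => infDist_nonneg) (sub_pos.2 hsN) (sub_lt_sub_left hrs (N : ℝ)) ht₀ (by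
        intro t ht
        have hpos : 0 < t ^ ((N : ℝ) - r) := Real.rpow_pos_of_pos ht.1 _
        have hlt : volume (nbhd N A t ∩ Ω) / ENNReal.ofReal (t ^ ((N : ℝ) - r)) ≤ 1 :=
          le_of_lt (hsub ht)
        rw [ENNReal.div_le_iff (by simpa using hpos) ENNReal.ofReal_ne_top, one_mul] at hlt
        rw [Measure.restrict_apply (measurableSet_lt hdm measurable_const)]
        exact hlt)
    refine IntegrableOn.mono_set (t := Ω) ?_ inter_subset_right
    refine Integrable.mono' hint hmeas.aestronglyMeasurable (Eventually.of_forall fun x => ?_)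
    rw [norm_cpow_eq_rpow_re_of_nonneg infDist_nonneg (by rw [hre]; linarith), hre, neg_sub]
  · have : IsFiniteMeasure (volume.restrict (nbhd N A δ ∩ Ω)) :=
      ⟨by simpa using (measure_mono inter_subset_right).trans_lt hfin⟩
    refine Integrable.of_bound hmeas.aestronglyMeasurable (max 1 (δ ^ (s.re - N))) ?_
    filter_upwards [ae_restrict_mem ((measurableSet_nbhd N A δ).inter hΩ)] with x hx
    rcases eq_or_lt_of_le (infDist_nonneg (x := x) (s := A)) with h0 | h0
    · refine le_max_of_le_left ?_
      rw [← h0, ofReal_zero, cpow_def, if_pos rfl]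
      split_ifs <;> simp
    · refine le_max_of_le_right ?_
      rw [norm_cpow_eq_rpow_re_of_pos h0, hre]
      exact Real.rpow_le_rpow h0.le (le_of_lt hx.1) (by linarith)

section BoundedIntegrand

variable {α : Type*} [MeasurableSpace α] {μ : Measure α} [IsFiniteMeasure μ] {g : α → ℝ}
  {a b : ℝ}

/-- The parametric integral `∫ g ^ (s - w)` is entire in `s` when `g` is bounded and bounded away
from zero. -/
theorem differentiable_integral_cpow (hg : Measurable g) (ha : 0 < a)
    (hab : ∀ᵐ x ∂μ, g x ∈ Icc a b) (w : ℂ) :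
    Differentiable ℂ fun s : ℂ => ∫ x, (g x : ℂ) ^ (s - w) ∂μ := by
  have hlog : ∀ᵐ x ∂μ, Real.log (g x) ∈ Icc (Real.log a) (Real.log b) := by
    filter_upwards [hab] with x hx
    exact ⟨Real.log_le_log ha hx.1, Real.log_le_log (ha.trans_le hx.1) hx.2⟩
  have hset : ProbabilityTheory.integrableExpSet (fun x => Real.log (g x)) μ = univ :=
    eq_univ_of_forall fun t => ProbabilityTheory.integrable_exp_mul_of_mem_Icc
      hg.log.aemeasurable hlog
  have hdiff := ProbabilityTheory.differentiableOn_complexMGF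
    (X := fun x => Real.log (g x)) (μ := μ)
  simp only [hset, interior_univ, mem_univ, ofPred_true, differentiableOn_univ] at hdiff
  have heq : (fun s : ℂ => ∫ x, (g x : ℂ) ^ (s - w) ∂μ) =
      fun s => ProbabilityTheory.complexMGF (fun x => Real.log (g x)) μ (s - w) := by
    funext s
    refine integral_congr_ae ?_
    filter_upwards [hab] with x hx
    have hx0 : 0 < g x := ha.trans_le hx.1
    rw [cpow_def_of_ne_zero (ofReal_ne_zero.2 hx0.ne'), ofReal_log hx0.le, mul_comm]
  rw [heq]
  exact hdiff.comp (differentiable_id.sub_const w)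

/-- The parametric integral `∫ g ^ (s - w)` is bounded on vertical strips when `g` is bounded and
bounded away from zero. -/
theorem exists_norm_integral_cpow_le (hg : ∀ᵐ x ∂μ, g x ∈ Icc a b) (ha : 0 < a) (w : ℂ)
    (l u : ℝ) :
    ∃ M : ℝ, ∀ s : ℂ, s.re ∈ Icc l u → ‖∫ x, (g x : ℂ) ^ (s - w) ∂μ‖ ≤ M := by
  set L := max |Real.log a| |Real.log b|
  set R := max |l| |u| + |w.re|
  refine ⟨Real.exp (L * R) * μ.real univ, fun s hs =>
    norm_integral_le_of_norm_le_const ?_⟩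
  filter_upwards [hg] with x hx
  have hx0 : 0 < g x := ha.trans_le hx.1
  rw [norm_cpow_eq_rpow_re_of_pos hx0, Real.rpow_def_of_pos hx0, Real.exp_le_exp]
  have hL : |Real.log (g x)| ≤ L :=
    abs_le_max_abs_abs (Real.log_le_log ha hx.1) (Real.log_le_log hx0 hx.2)
  have hR : |(s - w).re| ≤ R := by
    rw [sub_re]
    exact (abs_sub _ _).trans (add_le_add_left (abs_le_max_abs_abs hs.1 hs.2) _)
  refine (le_abs_self _).trans ?_
  rw [abs_mul]
  exact mul_le_mul hL hR (abs_nonneg _) ((abs_nonneg _).trans hL)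

end BoundedIntegrand

theorem ae_infDist_mem_Icc {N : ℕ} {A Ω : Set (EuclideanSpace ℝ (Fin N))} (hΩ : MeasurableSet Ω)
    (a b : ℝ) :
    ∀ᵐ x ∂volume.restrict ((nbhd N A b ∩ Ω) \ nbhd N A a), infDist x A ∈ Icc a b := by
  filter_upwards [ae_restrict_mem
    (((measurableSet_nbhd N A b).inter hΩ).diff (measurableSet_nbhd N A a))] with x hx
  exact ⟨not_lt.1 hx.2, le_of_lt hx.1.1⟩

theorem isFiniteMeasure_restrict_annulus {N : ℕ} {A Ω : Set (EuclideanSpace ℝ (Fin N))}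
    (hfin : volume Ω < ⊤) (a b : ℝ) :
    IsFiniteMeasure (volume.restrict ((nbhd N A b ∩ Ω) \ nbhd N A a)) :=
  ⟨by simpa using (measure_mono (sdiff_subset.trans inter_subset_right)).trans_lt hfin⟩

theorem differentiable_corrTerm {N : ℕ} {A Ω : Set (EuclideanSpace ℝ (Fin N))} {δ δ₁ : ℝ}
    (hΩ : MeasurableSet Ω) (hfin : volume Ω < ⊤) (hδ : 0 < δ) (hδ₁ : 0 < δ₁) :
    Differentiable ℂ (corrTerm N A Ω δ δ₁) := by
  have := isFiniteMeasure_restrict_annulus (A := A) hfin δ δ₁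
  have := isFiniteMeasure_restrict_annulus (A := A) hfin δ₁ δ
  have hdm : Measurable fun x : EuclideanSpace ℝ (Fin N) => infDist x A :=
    (continuous_infDist_pt A).measurable
  exact (differentiable_integral_cpow hdm hδ (ae_infDist_mem_Icc hΩ δ δ₁) _).sub
    (differentiable_integral_cpow hdm hδ₁ (ae_infDist_mem_Icc hΩ δ₁ δ) _)

theorem exists_norm_corrTerm_le {N : ℕ} {A Ω : Set (EuclideanSpace ℝ (Fin N))} {δ δ₁ : ℝ}
    (hΩ : MeasurableSet Ω) (hfin : volume Ω < ⊤) (hδ : 0 < δ) (hδ₁ : 0 < δ₁) (l u : ℝ) :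
    ∃ M : ℝ, 0 ≤ M ∧ ∀ s : ℂ, s.re ∈ Icc l u → ‖corrTerm N A Ω δ δ₁ s‖ ≤ M := by
  have := isFiniteMeasure_restrict_annulus (A := A) hfin δ δ₁
  have := isFiniteMeasure_restrict_annulus (A := A) hfin δ₁ δ
  obtain ⟨M₁, h₁⟩ := exists_norm_integral_cpow_le (ae_infDist_mem_Icc (A := A) hΩ δ δ₁) hδ N l u
  obtain ⟨M₂, h₂⟩ := exists_norm_integral_cpow_le (ae_infDist_mem_Icc (A := A) hΩ δ₁ δ) hδ₁ N l u
  exact ⟨max 0 (M₁ + M₂), le_max_left _ _, fun s hs =>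
    (norm_sub_le _ _).trans ((add_le_add (h₁ s hs) (h₂ s hs)).trans (le_max_right _ _))⟩

theorem distZetaD_eq_add_corrTerm {N : ℕ} {A Ω : Set (EuclideanSpace ℝ (Fin N))} {D : ℝ}
    (hΩ : MeasurableSet Ω) (hfin : volume Ω < ⊤) (hD : IsUpperMinkDim N A Ω D) (δ δ₁ : ℝ) {s : ℂ}
    (hs : D < s.re) :
    distZetaD N A Ω δ₁ s = distZetaD N A Ω δ s + corrTerm N A Ω δ δ₁ s := by
  have h₁ := integral_inter_add_sdiff (measurableSet_nbhd N A δ)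
    (integrableOn_infDist_cpow hΩ hfin hD δ₁ hs)
  have h₂ := integral_inter_add_sdiff (measurableSet_nbhd N A δ₁)
    (integrableOn_infDist_cpow hΩ hfin hD δ hs)
  have hset : nbhd N A δ₁ ∩ Ω ∩ nbhd N A δ = nbhd N A δ ∩ Ω ∩ nbhd N A δ₁ := by
    ext x
    simp only [mem_inter_iff]
    tauto
  rw [hset] at h₁
  simp only [distZetaD, corrTerm]
  rw [← h₁, ← h₂]
  ring

/-- Adding a term that is bounded on the relevant part of the window preserves languidity, with
exponent at least zero. -/
theorem LanguidWith.add_of_norm_le {F E : ℂ → ℂ} {S : ℝ → ℝ} {κ c C M l u : ℝ} {T : ℤ → ℝ}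
    (hF : LanguidWith F S κ c C T) (hM : 0 ≤ M) (hE : ∀ s : ℂ, s.re ∈ Icc l u → ‖E s‖ ≤ M)
    (hl : ∀ τ, l ≤ S τ) (hu : ∀ τ, S τ ≤ u) (hc : c ≤ u) :
    LanguidWith (fun s => F s + E s) S (max κ 0) c (C + M) T := by
  obtain ⟨hC, hT, hT₁, hT₂, hL₁, hL₂⟩ := hF
  have key : ∀ (s : ℂ) (y : ℝ), 1 ≤ y → s.re ∈ Icc l u → ‖F s‖ ≤ C * y ^ κ →
      ‖F s + E s‖ ≤ (C + M) * y ^ max κ 0 := by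
    intro s y hy hs hFs
    have h₁ : y ^ κ ≤ y ^ max κ 0 := Real.rpow_le_rpow_of_exponent_le hy (le_max_left _ _)
    have h₂ : 1 ≤ y ^ max κ 0 := Real.one_le_rpow hy (le_max_right _ _)
    calc ‖F s + E s‖ ≤ ‖F s‖ + ‖E s‖ := norm_add_le _ _
      _ ≤ C * y ^ κ + M := add_le_add hFs (hE s hs)
      _ ≤ C * y ^ max κ 0 + M * y ^ max κ 0 :=
        add_le_add (mul_le_mul_of_nonneg_left h₁ hC.le) (le_mul_of_one_le_right hM h₂)
      _ = (C + M) * y ^ max κ 0 := by ring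
  refine ⟨by linarith, hT, hT₁, hT₂, fun n σ h₁ h₂ => ?_, fun τ hτ => ?_⟩
  · refine key _ _ (by linarith [abs_nonneg (T n)]) ?_ (hL₁ n σ h₁ h₂)
    have := hl (T n)
    simpa using And.intro (this.trans h₁.le) (h₂.le.trans hc)
  · refine key _ _ hτ ?_ (hL₂ τ hτ)
    simpa using And.intro (hl τ) (hu τ)

/-- Let `(A,Ω)` be an RFD in `ℝ^N` and `δ, δ₁ > 0`.  Then: (i) the function `E = corrTerm`
is entire and `ζ_{A,Ω}(s;δ₁) = ζ_{A,Ω}(s;δ) + E(s)` for `Re s > dim̄_B(A,Ω)`;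
(ii) if `S` is a screen, `U` an open connected neighborhood of its window `W`, and `F`
a meromorphic extension of `ζ_{A,Ω}(·;δ)` to `U` satisfying (L1)–(L2) with exponent
`κ_d` (for some `c > N`, `C > 0` and admissible sequence `(T_n)`), then `F + E` is a
meromorphic extension of `ζ_{A,Ω}(·;δ₁)` to `U` and satisfies (L1)–(L2) with the same
screen, sequence and constant `c`, with exponent `max{κ_d, 0}` and some `C₁ > 0`. -/
theorem statement5
    (N : ℕ) (A Ω : Set (EuclideanSpace ℝ (Fin N))) (δ δ₁ Dbar : ℝ)
    (hRFD : IsRFD N A Ω) (hδ : 0 < δ) (hδ₁ : 0 < δ₁)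
    (hD : IsUpperMinkDim N A Ω Dbar) :
    (Differentiable ℂ (corrTerm N A Ω δ δ₁) ∧
      ∀ s : ℂ, Dbar < s.re →
        distZetaD N A Ω δ₁ s = distZetaD N A Ω δ s + corrTerm N A Ω δ δ₁ s) ∧
    (∀ (S : ℝ → ℝ) (U : Set ℂ) (F : ℂ → ℂ) (κd c C : ℝ) (T : ℤ → ℝ),
      IsScreen S Dbar → IsOpen U → IsPreconnected U → window S ⊆ U →
      MeromorphicOn F U →
      (∀ s ∈ U, Dbar < s.re → F s = distZetaD N A Ω δ s) →
      (N : ℝ) < c → LanguidWith F S κd c C T →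
      MeromorphicOn (fun s => F s + corrTerm N A Ω δ δ₁ s) U ∧
      (∀ s ∈ U, Dbar < s.re → F s + corrTerm N A Ω δ δ₁ s = distZetaD N A Ω δ₁ s) ∧
      ∃ C₁ : ℝ, 0 < C₁ ∧
        LanguidWith (fun s => F s + corrTerm N A Ω δ δ₁ s) S (max κd 0) c C₁ T) := by
  obtain ⟨-, hΩ, hfin, -⟩ := hRFD
  have hdiff := differentiable_corrTerm (A := A) hΩ hfin hδ hδ₁
  refine ⟨⟨hdiff, fun s hs => distZetaD_eq_add_corrTerm hΩ hfin hD δ δ₁ hs⟩, ?_⟩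
  intro S U F κd c C T hS _ _ _ hF hFeq _ hlang
  refine ⟨hF.add fun s _ => (hdiff.analyticAt s).meromorphicAt, fun s hsU hs => ?_, ?_⟩
  · rw [hFeq s hsU hs, distZetaD_eq_add_corrTerm hΩ hfin hD δ δ₁ hs]
  · obtain ⟨-, ⟨l, hl⟩, hSD⟩ := hS
    obtain ⟨M, hM, hE⟩ :=
      exists_norm_corrTerm_le (A := A) hΩ hfin hδ hδ₁ l (max c Dbar)
    have hadd := hlang.add_of_norm_le hM hE (fun τ => hl (mem_range_self τ))
      (fun τ => (hSD τ).trans (le_max_right _ _)) (le_max_left _ _)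
    exact ⟨C + M, hadd.1, hadd⟩

end
end
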